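/- Let Y be a finite-type-Dyck shift over a pushdown alphabet A and let Φ : Y → B^ℤ be a proper block map into a pushdown alphabet B. Then the image Φ(Y) is a sofic-Dyck shift over B. -/

import Mathlib

namespace SD

/-- The three kinds of letters of a pushdown alphabet. -/
inductive LetterKind : Type
  | call
  | ret
  | intern
  deriving DecidableEq

/-- A pushdown alphabet structure on `A`: a partition of the letters into
call letters, return letters and internal letters. -/
structure PushdownAlphabet (A : Type*) where
  kind : A → LetterKind

/-- Number of call letters of a word. -/
def callCount {A : Type*} (P : PushdownAlphabet A) (u : List A) : ℕ :=
  u.countP (fun a => decide (P.kind a = LetterKind.call))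

/-- Number of return letters of a word. -/
def retCount {A : Type*} (P : PushdownAlphabet A) (u : List A) : ℕ :=
  u.countP (fun a => decide (P.kind a = LetterKind.ret))

/-- A word is matched-return if every prefix has at least as many call letters
as return letters. -/
def MatchedReturn {A : Type*} (P : PushdownAlphabet A) (u : List A) : Prop :=
  ∀ v w : List A, u = v ++ w → retCount P v ≤ callCount P v

/-- A word is matched-call if every suffix has at least as many return letters
as call letters. -/
def MatchedCall {A : Type*} (P : PushdownAlphabet A) (u : List A) : Prop :=
  ∀ v w : List A, u = v ++ w → callCount P w ≤ retCount P w

/-- A Dyck word is a word which is both matched-return and matched-call. -/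
def IsDyck {A : Type*} (P : PushdownAlphabet A) (u : List A) : Prop :=
  MatchedReturn P u ∧ MatchedCall P u

/-- The factor of length `n` of a bi-infinite sequence starting at position `i`. -/
def factorAt {A : Type*} (x : ℤ → A) (i : ℤ) (n : ℕ) : List A :=
  (List.range n).map (fun k => x (i + (k : ℤ)))

/-- `w` is a (finite) factor of the bi-infinite sequence `x`. -/
def IsFactorOf {A : Type*} (w : List A) (x : ℤ → A) : Prop :=
  ∃ i : ℤ, w = factorAt x i w.length

/-- A Dyck automaton over alphabet `A` with states `Q`: a labeled graph together
with a set of matched pairs of edges. -/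
structure DyckAutomaton (A : Type*) (Q : Type*) where
  edges : Set (Q × A × Q)
  matched : Set ((Q × A × Q) × (Q × A × Q))

/-- Well-formedness of a Dyck automaton: matched pairs consist of edges of the
automaton, a call edge followed by a return edge. -/
def DyckAutomaton.WellFormed {A Q : Type*} (P : PushdownAlphabet A)
    (𝒜 : DyckAutomaton A Q) : Prop :=
  ∀ e f : Q × A × Q, (e, f) ∈ 𝒜.matched →
    e ∈ 𝒜.edges ∧ f ∈ 𝒜.edges ∧
    P.kind e.2.1 = LetterKind.call ∧ P.kind f.2.1 = LetterKind.ret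

/-- The label of a finite path. -/
def pathLabel {A Q : Type*} (π : List (Q × A × Q)) : List A :=
  π.map (fun e => e.2.1)

/-- A finite path of the underlying graph: a sequence of consecutive edges. -/
def IsPath {A Q : Type*} (𝒜 : DyckAutomaton A Q) (π : List (Q × A × Q)) : Prop :=
  (∀ e ∈ π, e ∈ 𝒜.edges) ∧ π.Chain' (fun e f => e.2.2 = f.1)

/-- A finite path is admissible if for any factor `e · π₁ · f` of it with `e` a call
edge, `f` a return edge and the label of `π₁` a Dyck word, `(e,f)` is a matched pair. -/
def IsAdmissible {A Q : Type*} (P : PushdownAlphabet A) (𝒜 : DyckAutomaton A Q)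
    (π : List (Q × A × Q)) : Prop :=
  IsPath 𝒜 π ∧
  ∀ (π₀ : List (Q × A × Q)) (e : Q × A × Q) (π₁ : List (Q × A × Q)) (f : Q × A × Q)
    (π₂ : List (Q × A × Q)), π = π₀ ++ e :: π₁ ++ f :: π₂ →
    P.kind e.2.1 = LetterKind.call → P.kind f.2.1 = LetterKind.ret →
    IsDyck P (pathLabel π₁) → (e, f) ∈ 𝒜.matched

/-- The finite factor of a bi-infinite path starting at index `i`, of length `n`. -/
def pathSeg {A Q : Type*} (π : ℤ → Q × A × Q) (i : ℤ) (n : ℕ) : List (Q × A × Q) :=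
  (List.range n).map (fun k => π (i + (k : ℤ)))

/-- A bi-infinite path is admissible if it is a bi-infinite path of the graph all of
whose finite factors are admissible. -/
def BiAdmissible {A Q : Type*} (P : PushdownAlphabet A) (𝒜 : DyckAutomaton A Q)
    (π : ℤ → Q × A × Q) : Prop :=
  (∀ i : ℤ, π i ∈ 𝒜.edges) ∧ (∀ i : ℤ, (π i).2.2 = (π (i + 1)).1) ∧
  ∀ (i : ℤ) (n : ℕ), IsAdmissible P 𝒜 (pathSeg π i n)

/-- The sofic-Dyck shift presented by a Dyck automaton: the set of labels of
bi-infinite admissible paths. -/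
def presents {A Q : Type*} (P : PushdownAlphabet A) (𝒜 : DyckAutomaton A Q) :
    Set (ℤ → A) :=
  { x | ∃ π : ℤ → Q × A × Q, BiAdmissible P 𝒜 π ∧ ∀ i : ℤ, (π i).2.1 = x i }

/-- A sofic-Dyck shift over `A`: a set presented by some (finite, well-formed)
Dyck automaton. -/
def IsSoficDyck {A : Type*} (P : PushdownAlphabet A) (X : Set (ℤ → A)) : Prop :=
  ∃ (N : ℕ) (𝒜 : DyckAutomaton A (Fin N)), 𝒜.WellFormed P ∧ X = presents P 𝒜

/-- A finite path goes from `p` to `q` (an empty path goes from `p` to `p`). -/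
def GoesFromTo {A Q : Type*} (π : List (Q × A × Q)) (p q : Q) : Prop :=
  (∀ e ∈ π.head?, e.1 = p) ∧ (∀ e ∈ π.getLast?, e.2.2 = q) ∧ (π = [] → p = q)

/-- A finite path starts at state `p`. -/
def StartsAt {A Q : Type*} (π : List (Q × A × Q)) (p : Q) : Prop :=
  ∀ e ∈ π.head?, e.1 = p

/-- A bi-infinite sequence avoids a set `F` of finite words if no finite factor of it
belongs to `F`. -/
def AvoidsWords {A : Type*} (F : Set (List A)) (x : ℤ → A) : Prop :=
  ∀ w : List A, IsFactorOf w x → w ∉ F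

/-- A bi-infinite sequence avoids a set `U` of pairs `((u₁,a,u₂),(v₁,b,v₂))` if for
every finite factor `v·a·w·b·z` of it with `a` call, `b` return and `w` a Dyck word,
no pair `((u₁,a,u₂),(v₁,b,v₂)) ∈ U` satisfies `(u₁,u₂) ⪯ (v, w·b·z)` and
`(v₁,v₂) ⪯ (v·a·w, z)`. -/
def AvoidsPairs {A : Type*} (P : PushdownAlphabet A)
    (U : Set ((List A × A × List A) × (List A × A × List A))) (x : ℤ → A) : Prop :=
  ∀ (v : List A) (a : A) (w : List A) (b : A) (z : List A),
    IsFactorOf (v ++ a :: w ++ b :: z) x →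
    P.kind a = LetterKind.call → P.kind b = LetterKind.ret → IsDyck P w →
    ∀ u₁ u₂ v₁ v₂ : List A, ((u₁, a, u₂), (v₁, b, v₂)) ∈ U →
      ¬(u₁ <:+ v ∧ u₂ <+: w ++ b :: z ∧ v₁ <:+ v ++ a :: w ∧ v₂ <+: z)

/-- A finite-type-Dyck shift over `A`: the set of bi-infinite sequences avoiding two
finite sets `F` and `U`. -/
def IsFiniteTypeDyck {A : Type*} (P : PushdownAlphabet A) (X : Set (ℤ → A)) : Prop :=
  ∃ (F : Set (List A)) (U : Set ((List A × A × List A) × (List A × A × List A))),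
    F.Finite ∧ U.Finite ∧
    (∀ u ∈ U, P.kind u.1.2.1 = LetterKind.call ∧ P.kind u.2.2.1 = LetterKind.ret) ∧
    X = { x | AvoidsWords F x ∧ AvoidsPairs P U x }

/-- `Φ` is an `(m,n)`-block map on `X` for some `m, n`: there is a block function `φ`
with `Φ(x)_i = φ(x_{i-m} ⋯ x_{i+n})` for all `x ∈ X` and `i ∈ ℤ`. -/
def IsBlockMapOn {A B : Type*} (X : Set (ℤ → A)) (Φ : (ℤ → A) → ℤ → B) : Prop :=
  ∃ (m n : ℕ) (φ : List A → B),
    ∀ x ∈ X, ∀ i : ℤ, Φ x i = φ (factorAt x (i - (m : ℤ)) (m + n + 1))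

/-- A map is proper on `X` if it sends call (resp. return, internal) letters to
call (resp. return, internal) letters. -/
def IsProperOn {A B : Type*} (P : PushdownAlphabet A) (PB : PushdownAlphabet B)
    (X : Set (ℤ → A)) (Φ : (ℤ → A) → ℤ → B) : Prop :=
  ∀ x ∈ X, ∀ i : ℤ, PB.kind (Φ x i) = P.kind (x i)

end SD

namespace SD

variable {A B Q : Type*}

theorem factorAt_eq_map (x : ℤ → A) (i : ℤ) (n : ℕ) :
    factorAt x i n = (List.range n).map fun k : ℕ => x (i + k) := by
  simp [factorAt, ← List.map_eq_flatMap]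

@[simp]
theorem length_factorAt (x : ℤ → A) (i : ℤ) (n : ℕ) : (factorAt x i n).length = n := by
  simp [factorAt_eq_map]

theorem pathSeg_eq_factorAt (π : ℤ → Q × A × Q) (i : ℤ) (n : ℕ) :
    pathSeg π i n = factorAt π i n :=
  rfl

theorem factorAt_congr {x y : ℤ → A} {i j : ℤ} {n : ℕ}
    (h : ∀ k : ℕ, k < n → x (i + k) = y (j + k)) : factorAt x i n = factorAt y j n := by
  rw [factorAt_eq_map, factorAt_eq_map]
  exact List.map_congr_left fun k hk => h k (List.mem_range.1 hk)

theorem factorAt_add (x : ℤ → A) (i : ℤ) (m n : ℕ) :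
    factorAt x i (m + n) = factorAt x i m ++ factorAt x (i + m) n := by
  simp [factorAt_eq_map, List.range_add, add_assoc]

theorem factorAt_succ (x : ℤ → A) (i : ℤ) (n : ℕ) :
    factorAt x i (n + 1) = x i :: factorAt x (i + 1) n := by
  rw [add_comm, factorAt_add]
  simp [factorAt_eq_map]

theorem map_factorAt (f : A → B) (x : ℤ → A) (i : ℤ) (n : ℕ) :
    (factorAt x i n).map f = factorAt (fun j => f (x j)) i n := by
  simp [factorAt_eq_map]

/-- The two parts of a factorization of a factor of `x` are themselves factors of `x`. -/
theorem eq_factorAt_of_append {x : ℤ → A} {i : ℤ} {n : ℕ} {u v : List A}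
    (h : u ++ v = factorAt x i n) :
    u = factorAt x i u.length ∧ v = factorAt x (i + u.length) v.length := by
  have hn : n = u.length + v.length := by
    simpa using (congrArg List.length h).symm
  subst hn
  rw [factorAt_add] at h
  exact List.append_inj h (by simp)

theorem eq_factorAt_of_cons {x : ℤ → A} {i : ℤ} {n : ℕ} {a : A} {v : List A}
    (h : a :: v = factorAt x i n) :
    a = x i ∧ v = factorAt x (i + 1) v.length := by
  have hn : n = v.length + 1 := by
    simpa using (congrArg List.length h).symm
  subst hn
  rw [factorAt_succ] at h
  simpa using h

theorem eq_factorAt_of_suffix {x : ℤ → A} {i : ℤ} {n : ℕ} {u : List A}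
    (h : u <:+ factorAt x i n) : u = factorAt x (i + n - u.length) u.length := by
  obtain ⟨t, ht⟩ := h
  have hn : t.length + u.length = n := by
    simpa using congrArg List.length ht
  have h₁ := (eq_factorAt_of_append ht).2
  have h₂ : i + n - u.length = i + t.length := by omega
  rwa [h₂]

theorem eq_factorAt_of_prefix {x : ℤ → A} {i : ℤ} {n : ℕ} {u : List A}
    (h : u <+: factorAt x i n) : u = factorAt x i u.length := by
  obtain ⟨t, ht⟩ := h
  exact (eq_factorAt_of_append ht).1

theorem factorAt_suffix (x : ℤ → A) {i j : ℤ} {m n : ℕ} (hmn : m ≤ n) (h : i + n = j + m) :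
    factorAt x j m <:+ factorAt x i n := by
  obtain ⟨k, rfl⟩ := Nat.exists_eq_add_of_le' hmn
  have hj : j = i + k := by push_cast at h; omega
  rw [factorAt_add, hj]
  exact List.suffix_append _ _

theorem factorAt_prefix (x : ℤ → A) (i : ℤ) {m n : ℕ} (hmn : m ≤ n) :
    factorAt x i m <+: factorAt x i n := by
  obtain ⟨k, rfl⟩ := Nat.exists_eq_add_of_le hmn
  rw [factorAt_add]
  exact List.prefix_append _ _

/-- Being a Dyck word only depends on the kinds of the letters. -/
theorem IsDyck.of_map_kind_eq {P : PushdownAlphabet A} {R : PushdownAlphabet B} {u : List A}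
    {v : List B} (h : u.map P.kind = v.map R.kind) (hu : IsDyck P u) : IsDyck R v := by
  have call_eq : ∀ (s : List A) (t : List B), s.map P.kind = t.map R.kind →
      callCount P s = callCount R t := fun s t hst => by
    have := congrArg (List.countP (fun k => decide (k = LetterKind.call))) hst
    simpa [List.countP_map, callCount, Function.comp_def] using this
  have ret_eq : ∀ (s : List A) (t : List B), s.map P.kind = t.map R.kind →
      retCount P s = retCount R t := fun s t hst => by
    have := congrArg (List.countP (fun k => decide (k = LetterKind.ret))) hst
    simpa [List.countP_map, retCount, Function.comp_def] using this
  have split : ∀ s t : List B, v = s ++ t → ∃ s' t' : List A, u = s' ++ t' ∧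
      s'.map P.kind = s.map R.kind ∧ t'.map P.kind = t.map R.kind := fun s t hst => by
    rw [hst, List.map_append] at h
    exact List.map_eq_append_iff.1 h
  constructor <;> intro s t hst <;> obtain ⟨s', t', hu', hs, ht⟩ := split s t hst
  · rw [← call_eq _ _ hs, ← ret_eq _ _ hs]
    exact hu.1 s' t' hu'
  · rw [← call_eq _ _ ht, ← ret_eq _ _ ht]
    exact hu.2 s' t' hu'

/-- The call letter at position `p` of `x` is matched with the return letter at position
`p + 1 + n`. -/
def MatchedAt (P : PushdownAlphabet A) (x : ℤ → A) (p : ℤ) (n : ℕ) : Prop :=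
  P.kind (x p) = LetterKind.call ∧ P.kind (x (p + 1 + n)) = LetterKind.ret ∧
    IsDyck P (factorAt x (p + 1) n)

theorem MatchedAt.of_kind_eq {P : PushdownAlphabet A} {R : PushdownAlphabet B} {x : ℤ → A}
    {y : ℤ → B} {p : ℤ} {n : ℕ} (h : ∀ i, P.kind (x i) = R.kind (y i))
    (hx : MatchedAt P x p n) : MatchedAt R y p n := by
  refine ⟨h p ▸ hx.1, h _ ▸ hx.2.1, hx.2.2.of_map_kind_eq ?_⟩
  simp [map_factorAt, h]

/-- The constraint `((u₁, a, u₂), (v₁, b, v₂))` can be read in `x` around the positions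
`p` and `q`. -/
def ReadsAt (x : ℤ → A) (p q : ℤ) (c : (List A × A × List A) × (List A × A × List A)) : Prop :=
  (c.1.1 = factorAt x (p - c.1.1.length) c.1.1.length ∧ c.1.2.1 = x p ∧
    c.1.2.2 = factorAt x (p + 1) c.1.2.2.length) ∧
  (c.2.1 = factorAt x (q - c.2.1.length) c.2.1.length ∧ c.2.2.1 = x q ∧
    c.2.2.2 = factorAt x (q + 1) c.2.2.2.length)

/-- Avoidance of pairs, expressed with positions. -/
theorem avoidsPairs_iff {P : PushdownAlphabet A}
    {U : Set ((List A × A × List A) × (List A × A × List A))} {x : ℤ → A} :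
    AvoidsPairs P U x ↔
      ∀ (p : ℤ) (n : ℕ), MatchedAt P x p n → ∀ c ∈ U, ¬ ReadsAt x p (p + 1 + n) c := by
  constructor
  · rintro h p n ⟨hc, hr, hd⟩ ⟨⟨u₁, a, u₂⟩, v₁, b, v₂⟩ hU ⟨⟨h₁, h₂, h₃⟩, h₄, h₅, h₆⟩
    dsimp only at h₁ h₂ h₃ h₄ h₅ h₆
    subst h₂ h₅
    set k := u₁.length + v₁.length with hk
    set l := u₂.length + v₂.length with hl
    have hz : factorAt x (p + 1) n ++ x (p + 1 + n) :: factorAt x (p + 1 + n + 1) l =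
        factorAt x (p + 1) (n + (l + 1)) := by
      rw [factorAt_add x _ n, factorAt_succ x _ l]
    have hv : factorAt x (p - k) k ++ x p :: factorAt x (p + 1) n =
        factorAt x (p - k) (k + (n + 1)) := by
      rw [factorAt_add x _ k, factorAt_succ, sub_add_cancel]
    refine h (factorAt x (p - k) k) (x p) (factorAt x (p + 1) n) (x (p + 1 + n))
      (factorAt x (p + 1 + n + 1) l) ⟨p - k, ?_⟩ hc hr hd u₁ u₂ v₁ v₂ hU ⟨?_, ?_, ?_, ?_⟩
    · simp only [hv, List.length_append, List.length_cons, length_factorAt]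
      rw [factorAt_add x _ (k + (n + 1)), factorAt_succ x _ l]
      have : p - k + ((k + (n + 1) : ℕ) : ℤ) = p + 1 + n := by push_cast; ring
      rw [this]
    · rw [h₁]
      exact factorAt_suffix x (by omega) (by omega)
    · rw [hz, h₃]
      exact factorAt_prefix x _ (by omega)
    · rw [hv, h₄]
      exact factorAt_suffix x (by omega) (by omega)
    · rw [h₆]
      exact factorAt_prefix x _ (by omega)
  · rintro h v a w b z ⟨i, hi⟩ hc hr hd u₁ u₂ v₁ v₂ hU ⟨h₁, h₂, h₃, h₄⟩
    obtain ⟨hvw, hbz⟩ := eq_factorAt_of_append hi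
    obtain ⟨hv, haw⟩ := eq_factorAt_of_append hvw
    obtain ⟨ha, hw⟩ := eq_factorAt_of_cons haw
    obtain ⟨hb, hz⟩ := eq_factorAt_of_cons hbz
    have hq : i + ((v ++ a :: w).length : ℤ) = i + v.length + 1 + w.length := by
      simp; ring
    rw [hq] at hbz hb hz
    have hwz : w ++ b :: z = factorAt x (i + v.length + 1) (w.length + (b :: z).length) := by
      rw [factorAt_add, ← hbz, ← hw]
    refine h (i + v.length) w.length ⟨ha ▸ hc, hb ▸ hr, hw ▸ hd⟩ _ hU
      ⟨⟨?_, ha, ?_⟩, ?_, hb, ?_⟩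
    · rw [hv] at h₁
      exact eq_factorAt_of_suffix h₁
    · rw [hwz] at h₂
      exact eq_factorAt_of_prefix h₂
    · rw [hvw] at h₃
      rw [← hq]
      exact eq_factorAt_of_suffix h₃
    · rw [hz] at h₄
      exact eq_factorAt_of_prefix h₄

/-- `x` around `i` and `y` around `j` agree at distance at most `K`. -/
def AgreeNear (K : ℕ) (x : ℤ → A) (i : ℤ) (y : ℤ → A) (j : ℤ) : Prop :=
  ∀ d : ℤ, -K ≤ d → d ≤ K → x (i + d) = y (j + d)

theorem AgreeNear.apply_eq {K : ℕ} {x y : ℤ → A} {i j : ℤ} (h : AgreeNear K x i y j) :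
    x i = y j := by
  simpa using h 0 (by simp) (by simp)

theorem AgreeNear.factorAt_eq {K : ℕ} {x y : ℤ → A} {i j : ℤ} (h : AgreeNear K x i y j)
    {e : ℤ} {n : ℕ} (h₁ : -K ≤ e) (h₂ : e + n ≤ K + 1) :
    factorAt x (i + e) n = factorAt y (j + e) n :=
  factorAt_congr fun k hk => by
    simpa [add_assoc] using h (e + k) (by omega) (by omega)

theorem ReadsAt.congr {K : ℕ} {x y : ℤ → A} {p q p' q' : ℤ}
    {c : (List A × A × List A) × (List A × A × List A)} (hx : ReadsAt x p q c)
    (hp : AgreeNear K x p y p') (hq : AgreeNear K x q y q')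
    (h₁ : c.1.1.length ≤ K) (h₂ : c.1.2.2.length ≤ K) (h₃ : c.2.1.length ≤ K)
    (h₄ : c.2.2.2.length ≤ K) : ReadsAt y p' q' c := by
  obtain ⟨⟨e₁, e₂, e₃⟩, e₄, e₅, e₆⟩ := hx
  refine ⟨⟨e₁.trans ?_, e₂.trans hp.apply_eq, e₃.trans ?_⟩, e₄.trans ?_,
    e₅.trans hq.apply_eq, e₆.trans ?_⟩
  · exact hp.factorAt_eq (by omega) (by omega)
  · exact hp.factorAt_eq (by omega) (by omega)
  · exact hq.factorAt_eq (by omega) (by omega)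
  · exact hq.factorAt_eq (by omega) (by omega)

/-- A family of sequences, consecutive members of which agree around consecutive positions,
glues to a single sequence. -/
theorem exists_agreeNear {K : ℕ} (x : ℤ → ℤ → A) (p : ℤ → ℤ)
    (h : ∀ i, AgreeNear K (x i) (p i + 1) (x (i + 1)) (p (i + 1))) :
    ∃ y : ℤ → A, ∀ i, AgreeNear K y i (x i) (p i) := by
  have pos : ∀ d : ℕ, d ≤ K → ∀ i, x (i + d) (p (i + d)) = x i (p i + d) := by
    intro d
    induction d with
    | zero => simp
    | succ d ih =>
      intro hd i
      have h₁ := h i d (by omega) (by omega)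
      have h₂ := ih (by omega) (i + 1)
      push_cast
      rw [add_comm (d : ℤ) 1, ← add_assoc, ← add_assoc, h₂, h₁]
  have neg : ∀ d : ℕ, d ≤ K → ∀ i, x (i - d) (p (i - d)) = x i (p i - d) := by
    intro d
    induction d with
    | zero => simp
    | succ d ih =>
      intro hd i
      have h₁ := h (i - 1) (-(d + 1 : ℕ)) (by omega) (by omega)
      have h₂ := ih (by omega) (i - 1)
      rw [sub_add_cancel] at h₁
      rw [← sub_eq_add_neg, ← sub_eq_add_neg] at h₁
      rw [← h₁]
      push_cast
      rw [add_comm (d : ℤ) 1, ← sub_sub, h₂, ← sub_sub, add_sub_cancel_right]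
  refine ⟨fun i => x i (p i), fun i d h₁ h₂ => ?_⟩
  obtain ⟨k, rfl | rfl⟩ := d.eq_nat_or_neg
  · exact pos k (by omega) i
  · simpa [sub_eq_add_neg] using neg k (by omega) i

/-- Windows of radius `K` over a finite alphabet can be coded by finitely many states. -/
theorem exists_window_code (A : Type*) [Finite A] (K : ℕ) :
    ∃ (N : ℕ) (W : (ℤ → A) → ℤ → Fin N),
      ∀ x y i j, W x i = W y j → AgreeNear K x i y j := by
  obtain ⟨N, ⟨e⟩⟩ := Finite.exists_equiv_fin (Fin (2 * K + 1) → A)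
  refine ⟨N, fun x i => e fun k => x (i + (k - K)), fun x y i j h d h₁ h₂ => ?_⟩
  have h₃ := congrFun (e.injective h) ⟨(d + K).toNat, by omega⟩
  have h₄ : ((d + K).toNat : ℤ) - K = d := by omega
  simpa only [h₄] using h₃

/-- The Dyck automaton whose edges, and matched pairs of edges, are those occurring along the
paths attached to the sequences of `Y`, when `W` gives the states and `Φ` the labels. -/
def windowAutomaton (P : PushdownAlphabet A) (Y : Set (ℤ → A)) (W : (ℤ → A) → ℤ → Q)
    (Φ : (ℤ → A) → ℤ → B) : DyckAutomaton B Q where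
  edges := {e | ∃ x ∈ Y, ∃ i, e = (W x i, Φ x i, W x (i + 1))}
  matched := {c | ∃ x ∈ Y, ∃ (p : ℤ) (n : ℕ), MatchedAt P x p n ∧
    c = ((W x p, Φ x p, W x (p + 1)),
      (W x (p + 1 + n), Φ x (p + 1 + n), W x (p + 1 + n + 1)))}

theorem wellFormed_windowAutomaton {P : PushdownAlphabet A} {R : PushdownAlphabet B}
    {Y : Set (ℤ → A)} {W : (ℤ → A) → ℤ → Q} {Φ : (ℤ → A) → ℤ → B}
    (hp : IsProperOn P R Y Φ) : (windowAutomaton P Y W Φ).WellFormed R := by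
  rintro e f ⟨x, hx, p, n, ⟨hc, hr, -⟩, h⟩
  obtain ⟨rfl, rfl⟩ := Prod.mk.inj h
  exact ⟨⟨x, hx, p, rfl⟩, ⟨x, hx, _, rfl⟩, (hp x hx _).trans hc, (hp x hx _).trans hr⟩

theorem mem_presents_windowAutomaton {P : PushdownAlphabet A} {R : PushdownAlphabet B}
    {Y : Set (ℤ → A)} {W : (ℤ → A) → ℤ → Q} {Φ : (ℤ → A) → ℤ → B}
    (hp : IsProperOn P R Y Φ) {x : ℤ → A} (hx : x ∈ Y) :
    Φ x ∈ presents R (windowAutomaton P Y W Φ) := by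
  refine ⟨fun i => (W x i, Φ x i, W x (i + 1)),
    ⟨fun i => ⟨x, hx, i, rfl⟩, fun i => rfl, fun i n => ⟨⟨?_, ?_⟩, ?_⟩⟩, fun i => rfl⟩
  · intro e he
    rw [pathSeg_eq_factorAt, factorAt_eq_map] at he
    obtain ⟨k, -, rfl⟩ := List.mem_map.1 he
    exact ⟨x, hx, _, rfl⟩
  · refine List.isChain_iff_getElem.2 fun k hk => ?_
    simp [pathSeg_eq_factorAt, factorAt_eq_map, add_assoc]
  · intro π₀ e π₁ f π₂ h hc hr hd
    rw [pathSeg_eq_factorAt] at h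
    obtain ⟨h₁, h₂⟩ := eq_factorAt_of_append h.symm
    obtain ⟨-, h₃⟩ := eq_factorAt_of_append h₁
    obtain ⟨he, hπ⟩ := eq_factorAt_of_cons h₃
    obtain ⟨hf, -⟩ := eq_factorAt_of_cons h₂
    have hq : i + ((π₀ ++ e :: π₁).length : ℤ) = i + π₀.length + 1 + π₁.length := by
      simp; ring
    rw [hq] at hf
    have hm : MatchedAt R (Φ x) (i + π₀.length) π₁.length := by
      subst he hf
      refine ⟨hc, hr, ?_⟩
      rw [hπ, pathLabel, map_factorAt] at hd
      exact hd
    exact ⟨x, hx, i + π₀.length, π₁.length, hm.of_kind_eq (hp x hx), Prod.ext he hf⟩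

/-- Matched positions of the label of an admissible path carry matched edges. -/
theorem BiAdmissible.mem_matched {R : PushdownAlphabet B} {𝒜 : DyckAutomaton B Q}
    {π : ℤ → Q × B × Q} (h : BiAdmissible R 𝒜 π) {p : ℤ} {n : ℕ}
    (hm : MatchedAt R (fun i => (π i).2.1) p n) : (π p, π (p + 1 + n)) ∈ 𝒜.matched := by
  refine (h.2.2 p (n + 1 + 1)).2 [] (π p) (factorAt π (p + 1) n) (π (p + 1 + n)) [] ?_
    hm.1 hm.2.1 ?_
  · rw [pathSeg_eq_factorAt, factorAt_succ, factorAt_add]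
    simp [factorAt_eq_map]
  · rw [pathLabel, map_factorAt]
    exact hm.2.2

end SD

open SD

/-- The image of a finite-type-Dyck shift under a proper block map is a sofic-Dyck
shift. -/
theorem statement_4 {A B : Type*} [Fintype A] [Fintype B]
    (P : PushdownAlphabet A) (PB : PushdownAlphabet B)
    (Y : Set (ℤ → A)) (Φ : (ℤ → A) → ℤ → B)
    (hY : IsFiniteTypeDyck P Y) (hΦ : IsBlockMapOn Y Φ) (hp : IsProperOn P PB Y Φ) :
    IsSoficDyck PB (Φ '' Y) := by
  obtain ⟨F, U, hF, hU, -, hYeq⟩ := hY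
  obtain ⟨m, n, φ, hφ⟩ := hΦ
  obtain ⟨KF, hKF⟩ := (hF.image List.length).bddAbove
  obtain ⟨KU, hKU⟩ := (hU.image fun c =>
    c.1.1.length + c.1.2.2.length + c.2.1.length + c.2.2.2.length).bddAbove
  obtain ⟨N, W, hW⟩ := exists_window_code A (m + n + KF + KU)
  refine ⟨N, windowAutomaton P Y W Φ, wellFormed_windowAutomaton hp, Set.Subset.antisymm ?_ ?_⟩
  · rintro _ ⟨x, hx, rfl⟩
    exact mem_presents_windowAutomaton hp hx
  · rintro z ⟨π, hπ, hz⟩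
    choose x hxY p hx using hπ.1
    obtain ⟨y, hy⟩ := exists_agreeNear x p fun i => hW _ _ _ _ <| by
      have := hπ.2.1 i
      rwa [hx i, hx (i + 1)] at this
    have hkind : ∀ i, P.kind (y i) = PB.kind (π i).2.1 := fun i => by
      rw [(hy i).apply_eq, ← hp _ (hxY i), hx i]
    have hyY : y ∈ Y := by
      rw [hYeq]
      refine ⟨?_, avoidsPairs_iff.2 ?_⟩
      · rintro w ⟨i, hi⟩ hw
        have hlen : w.length ≤ KF := hKF ⟨w, hw, rfl⟩
        have hxi := hxY i
        rw [hYeq] at hxi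
        refine hxi.1 w ⟨p i, hi.trans ?_⟩ hw
        simpa using (hy i).factorAt_eq (e := 0) (n := w.length) (by omega) (by omega)
      · intro q k hm c hc hread
        have hlen : c.1.1.length + c.1.2.2.length + c.2.1.length + c.2.2.2.length ≤ KU :=
          hKU ⟨c, hc, rfl⟩
        obtain ⟨x', hx', q', k', hm', he⟩ := hπ.mem_matched (hm.of_kind_eq hkind)
        obtain ⟨he₁, he₂⟩ := Prod.mk.inj he
        have key : ∀ s s', π s = (W x' s', Φ x' s', W x' (s' + 1)) →
            AgreeNear (m + n + KF + KU) y s x' s' := fun s s' hs d h₁ h₂ =>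
          (hy s d h₁ h₂).trans <| hW _ _ _ _
            (congrArg Prod.fst ((hx s).symm.trans hs)) d h₁ h₂
        rw [hYeq] at hx'
        exact avoidsPairs_iff.1 hx'.2 q' k' hm' c hc <| hread.congr (key _ _ he₁) (key _ _ he₂)
          (by omega) (by omega) (by omega) (by omega)
    refine ⟨y, hyY, funext fun i => ?_⟩
    rw [← hz i, hx i, hφ y hyY, hφ _ (hxY i)]
    exact congrArg φ ((hy i).factorAt_eq (e := -m) (by omega) (by push_cast; omega))
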